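/- Let L be a factorial and almost prolongable language over a finite alphabet with unbounded complexity, and suppose there exists N₀ such that e(n) = 0 for all n ≥ N₀. Suppose there exist reals α ∈ [0, 1/3) and β ∈ [1, 4/3) such that e_l(n) = O(n^α), e_r(n) = O(n^α), and p(n) = O(n^β). Then lim_{n→∞} p(n+1)/p(n) = 1. (First case of Corollary 2.8 of the paper, stated via the paper's equivalent complexity criterion for convergence of the Rauzy digraphs to the directed line.) -/

import Mathlib

open Filter Topology

variable {A : Type*}

/-- The set of words of `L` of length `n`. -/
def Ln (L : Set (List A)) (n : ℕ) : Set (List A) := {w | w ∈ L ∧ w.length = n}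

/-- The complexity function `p n = |L_n|`. -/
noncomputable def cplx (L : Set (List A)) (n : ℕ) : ℕ := Nat.card (Ln L n)

/-- A language is factorial if it is closed under taking contiguous subwords. -/
def IsFactorial (L : Set (List A)) : Prop := ∀ u v : List A, u ∈ L → v <:+: u → v ∈ L

/-- `w` is left-prolongable in `L`. -/
def LeftProlongable (L : Set (List A)) (w : List A) : Prop := ∃ a : A, (a :: w) ∈ L

/-- `w` is right-prolongable in `L`. -/
def RightProlongable (L : Set (List A)) (w : List A) : Prop := ∃ b : A, (w ++ [b]) ∈ L

/-- `e_l(n)`: the number of words of length `n` in `L` that are not left-prolongable. -/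
noncomputable def eL (L : Set (List A)) (n : ℕ) : ℕ :=
  Nat.card {w : List A | w ∈ Ln L n ∧ ¬ LeftProlongable L w}

/-- `e_r(n)`: the number of words of length `n` in `L` that are not right-prolongable. -/
noncomputable def eR (L : Set (List A)) (n : ℕ) : ℕ :=
  Nat.card {w : List A | w ∈ Ln L n ∧ ¬ RightProlongable L w}

/-- `L` is almost prolongable: `e_l(n)/p(n) → 0` and `e_r(n)/p(n) → 0`. -/
def AlmostProlongable (L : Set (List A)) : Prop :=
  Tendsto (fun n => (eL L n : ℝ) / (cplx L n : ℝ)) atTop (𝓝 0) ∧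
  Tendsto (fun n => (eR L n : ℝ) / (cplx L n : ℝ)) atTop (𝓝 0)

/-- `e(n)`: the number of words of length `n` in `L` that are neither left- nor
right-prolongable. -/
noncomputable def eBoth (L : Set (List A)) (n : ℕ) : ℕ :=
  Nat.card {w : List A | w ∈ Ln L n ∧ ¬ LeftProlongable L w ∧ ¬ RightProlongable L w}

/-- The words of length `n` with two distinct right extensions in `L`. -/
def RightSpecial (L : Set (List A)) (n : ℕ) : Set (List A) :=
  {w | w.length = n ∧ ∃ a b : A, a ≠ b ∧ w ++ [a] ∈ L ∧ w ++ [b] ∈ L}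

/-- The words of length `n` with two distinct left extensions in `L`. -/
def LeftSpecial (L : Set (List A)) (n : ℕ) : Set (List A) :=
  {w | w.length = n ∧ ∃ a b : A, a ≠ b ∧ a :: w ∈ L ∧ b :: w ∈ L}

/-- The words of length `n` with two distinct right special left extensions. -/
def Branching (L : Set (List A)) (n : ℕ) : Set (List A) :=
  {w | w.length = n ∧ ∃ a b : A, a ≠ b ∧
    a :: w ∈ RightSpecial L (n + 1) ∧ b :: w ∈ RightSpecial L (n + 1)}

theorem finite_of_length_eq [Fintype A] {S : Set (List A)} {n : ℕ}
    (h : ∀ w ∈ S, w.length = n) : S.Finite :=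
  (List.finite_length_eq A n).subset h

theorem Ln_finite [Fintype A] (L : Set (List A)) (n : ℕ) : (Ln L n).Finite :=
  finite_of_length_eq fun _ h => h.2

theorem RightSpecial_finite [Fintype A] (L : Set (List A)) (n : ℕ) : (RightSpecial L n).Finite :=
  finite_of_length_eq fun _ h => h.1

theorem LeftSpecial_finite [Fintype A] (L : Set (List A)) (n : ℕ) : (LeftSpecial L n).Finite :=
  finite_of_length_eq fun _ h => h.1

theorem Branching_finite [Fintype A] (L : Set (List A)) (n : ℕ) : (Branching L n).Finite :=
  finite_of_length_eq fun _ h => h.1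

/-- A set mapped to `T`, with fibres labelled injectively by `C` and nontrivial only over `B`,
has at most `|T| + |C| |B|` elements. -/
theorem ncard_le_add_mul_of_fibres {X Y C : Type*} [Fintype C] {S : Set X} {T B : Set Y}
    (hT : T.Finite) (hB : B.Finite) (f : X → Y) (g : X → C)
    (hmap : ∀ x ∈ S, f x ∈ T)
    (hinj : ∀ x ∈ S, ∀ y ∈ S, f x = f y → g x = g y → x = y)
    (hmul : ∀ x ∈ S, ∀ y ∈ S, f x = f y → x ≠ y → f x ∈ B) :
    S.ncard ≤ T.ncard + Fintype.card C * B.ncard := by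
  have hsub : S ⊆ {x ∈ S | f x ∉ B} ∪ {x ∈ S | f x ∈ B} := by
    intro x hx
    by_cases h : f x ∈ B
    · exact Or.inr ⟨hx, h⟩
    · exact Or.inl ⟨hx, h⟩
  have hf1 : Set.InjOn f {x ∈ S | f x ∉ B} := by
    intro x hx y hy hxy
    by_contra hne
    exact hx.2 (hmul x hx.1 y hy.1 hxy hne)
  have hm1 : ∀ x ∈ {x ∈ S | f x ∉ B}, f x ∈ T := fun x hx => hmap x hx.1
  have hf2 : Set.InjOn (fun x => (g x, f x)) {x ∈ S | f x ∈ B} := by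
    intro x hx y hy hxy
    simp only [Prod.mk.injEq] at hxy
    exact hinj x hx.1 y hy.1 hxy.2 hxy.1
  have hm2 : ∀ x ∈ {x ∈ S | f x ∈ B}, (g x, f x) ∈ (Set.univ : Set C) ×ˢ B :=
    fun x hx => ⟨Set.mem_univ _, hx.2⟩
  have hfin2 : ((Set.univ : Set C) ×ˢ B).Finite := Set.finite_univ.prod hB
  have h1 := Set.ncard_le_ncard_of_injOn f hm1 hf1 hT
  have h2 := Set.ncard_le_ncard_of_injOn _ hm2 hf2 hfin2
  rw [Set.ncard_prod, Set.ncard_univ, Nat.card_eq_fintype_card] at h2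
  have hfS : ({x ∈ S | f x ∉ B} ∪ {x ∈ S | f x ∈ B}).Finite :=
    (Set.Finite.of_injOn hm1 hf1 hT).union (Set.Finite.of_injOn hm2 hf2 hfin2)
  calc S.ncard ≤ _ := Set.ncard_le_ncard hsub hfS
    _ ≤ _ := Set.ncard_union_le _ _
    _ ≤ _ := add_le_add h1 h2

theorem cplx_succ_le [Fintype A] {L : Set (List A)} (hfac : IsFactorial L) (n : ℕ) :
    cplx L (n + 1) ≤ cplx L n + Fintype.card (Option A) * (RightSpecial L n).ncard := by
  have key : ∀ x ∈ Ln L (n + 1), ∃ y a, x = y ++ [a] := by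
    intro x hx
    rcases List.eq_nil_or_concat x with h | ⟨y, a, h⟩
    · have := hx.2
      simp [h] at this
    · exact ⟨y, a, by simpa using h⟩
  refine ncard_le_add_mul_of_fibres (Ln_finite L n) (RightSpecial_finite L n)
    List.dropLast List.getLast? ?_ ?_ ?_
  · intro x hx
    obtain ⟨y, a, rfl⟩ := key x hx
    have hl := hx.2
    simp only [List.length_append, List.length_singleton] at hl
    rw [List.dropLast_concat]
    exact ⟨hfac _ _ hx.1 ⟨[], [a], by simp⟩, by omega⟩
  · intro x hx x' hx' h h'
    obtain ⟨y, a, rfl⟩ := key x hx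
    obtain ⟨y', a', rfl⟩ := key x' hx'
    simp_all
  · intro x hx x' hx' h h'
    obtain ⟨y, a, rfl⟩ := key x hx
    obtain ⟨y', a', rfl⟩ := key x' hx'
    have hl := hx.2
    simp only [List.length_append, List.length_singleton] at hl
    simp only [List.dropLast_concat] at h ⊢
    subst h
    exact ⟨by omega, a, a', by simpa using h', hx.1, hx'.1⟩

theorem ncard_RightSpecial_succ_le [Fintype A] {L : Set (List A)} (hfac : IsFactorial L) (n : ℕ) :
    (RightSpecial L (n + 1)).ncard ≤
      (RightSpecial L n).ncard + Fintype.card (Option A) * (Branching L n).ncard := by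
  have key : ∀ x ∈ RightSpecial L (n + 1), ∃ a y, x = a :: y := by
    intro x hx
    cases x with
    | nil => have := hx.1; simp at this
    | cons a y => exact ⟨a, y, rfl⟩
  refine ncard_le_add_mul_of_fibres (RightSpecial_finite L n) (Branching_finite L n)
    List.tail List.head? ?_ ?_ ?_
  · intro x hx
    obtain ⟨a, y, rfl⟩ := key x hx
    obtain ⟨hl, b, c, hbc, hb, hc⟩ := hx
    exact ⟨by simpa using hl, b, c, hbc, hfac _ _ hb ⟨[a], [], by simp⟩,
      hfac _ _ hc ⟨[a], [], by simp⟩⟩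
  · intro x hx x' hx' h h'
    obtain ⟨a, y, rfl⟩ := key x hx
    obtain ⟨a', y', rfl⟩ := key x' hx'
    simp_all
  · intro x hx x' hx' h h'
    obtain ⟨a, y, rfl⟩ := key x hx
    obtain ⟨a', y', rfl⟩ := key x' hx'
    simp only [List.tail_cons] at h ⊢
    subst h
    exact ⟨by simpa using hx.1, a, a', by simpa using h', hx, hx'⟩

theorem ncard_RightSpecial_add_le [Fintype A] {L : Set (List A)} (hfac : IsFactorial L) (n m : ℕ) :
    (RightSpecial L (n + m)).ncard ≤ (RightSpecial L n).ncard +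
      Fintype.card (Option A) * ∑ i ∈ Finset.range m, (Branching L (n + i)).ncard := by
  induction m with
  | zero => simp
  | succ m ih =>
    have := ncard_RightSpecial_succ_le hfac (n + m)
    rw [Finset.sum_range_succ, mul_add, ← add_assoc n m 1]
    omega

/-- If `S` is the set of words with an extension and `T` the set of those with two extensions, the
extensions being taken by an injective operation `ext`, then `L` contains `|S| + |T|` extensions. -/
theorem ncard_add_ncard_le_of_extensions {X Y C : Type*} {S T : Set X} {E : Set Y} (hE : E.Finite)
    (ext : X → C → Y) (hext : ∀ x y a b, ext x a = ext y b → x = y ∧ a = b)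
    (hS : ∀ x ∈ S, ∃ a, ext x a ∈ E) (hTS : T ⊆ S)
    (hT : ∀ x ∈ T, ∃ a b, a ≠ b ∧ ext x a ∈ E ∧ ext x b ∈ E) :
    S.ncard + T.ncard ≤ E.ncard := by
  classical
  rcases S.eq_empty_or_nonempty with rfl | ⟨x₀, hx₀⟩
  · have : T = ∅ := Set.subset_empty_iff.mp hTS
    simp [this]
  obtain ⟨c₀, -⟩ := hS x₀ hx₀
  have hf : ∀ x, ∃ a, x ∈ S → ext x a ∈ E := by
    intro x
    by_cases hx : x ∈ S
    · obtain ⟨a, ha⟩ := hS x hx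
      exact ⟨a, fun _ => ha⟩
    · exact ⟨c₀, fun h => absurd h hx⟩
  choose f hf using hf
  have hg : ∀ x, ∃ a, x ∈ T → a ≠ f x ∧ ext x a ∈ E := by
    intro x
    by_cases hx : x ∈ T
    · obtain ⟨a, b, hab, ha, hb⟩ := hT x hx
      by_cases h : a = f x
      · exact ⟨b, fun _ => ⟨fun h' => hab (h.trans h'.symm), hb⟩⟩
      · exact ⟨a, fun _ => ⟨h, ha⟩⟩
    · exact ⟨c₀, fun h => absurd h hx⟩
  choose g hg using hg
  have h1 : ((fun x => ext x (f x)) '' S).ncard = S.ncard :=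
    Set.InjOn.ncard_image fun x _ y _ h => (hext _ _ _ _ h).1
  have h2 : ((fun x => ext x (g x)) '' T).ncard = T.ncard :=
    Set.InjOn.ncard_image fun x _ y _ h => (hext _ _ _ _ h).1
  have hs1 : (fun x => ext x (f x)) '' S ⊆ E := by
    rintro _ ⟨x, hx, rfl⟩
    exact hf x hx
  have hs2 : (fun x => ext x (g x)) '' T ⊆ E := by
    rintro _ ⟨x, hx, rfl⟩
    exact (hg x hx).2
  have hd : Disjoint ((fun x => ext x (f x)) '' S) ((fun x => ext x (g x)) '' T) := by
    rw [Set.disjoint_left]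
    rintro _ ⟨x, hx, rfl⟩ ⟨y, hy, h⟩
    obtain ⟨rfl, h⟩ := hext _ _ _ _ h
    exact (hg y hy).1 h
  rw [← h1, ← h2, ← Set.ncard_union_eq hd (hE.subset hs1) (hE.subset hs2)]
  exact Set.ncard_le_ncard (Set.union_subset hs1 hs2) hE

theorem cplx_eq_ncard_add_eR [Fintype A] (L : Set (List A)) (n : ℕ) :
    cplx L n = {w ∈ Ln L n | RightProlongable L w}.ncard + eR L n := by
  have h := Set.ncard_inter_add_ncard_sdiff_eq_ncard (Ln L n) {w | RightProlongable L w}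
    (Ln_finite L n)
  exact h.symm

theorem cplx_eq_ncard_add_eL [Fintype A] (L : Set (List A)) (n : ℕ) :
    cplx L n = {w ∈ Ln L n | LeftProlongable L w}.ncard + eL L n := by
  have h := Set.ncard_inter_add_ncard_sdiff_eq_ncard (Ln L n) {w | LeftProlongable L w}
    (Ln_finite L n)
  exact h.symm

theorem ncard_RightSpecial_add_cplx_le [Fintype A] {L : Set (List A)} (hfac : IsFactorial L)
    (n : ℕ) : (RightSpecial L n).ncard + cplx L n ≤ cplx L (n + 1) + eR L n := by
  have h := ncard_add_ncard_le_of_extensions (S := {w ∈ Ln L n | RightProlongable L w})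
    (T := RightSpecial L n) (Ln_finite L (n + 1)) (fun w (a : A) => w ++ [a])
    (by intro x y a b h; simpa using List.append_inj' h rfl)
    (by rintro x ⟨hx, a, ha⟩; exact ⟨a, ha, by simp [hx.2]⟩)
    (by
      rintro x ⟨hl, a, b, -, ha, -⟩
      exact ⟨⟨hfac _ _ ha ⟨[], [a], by simp⟩, hl⟩, a, ha⟩)
    (by rintro x ⟨hl, a, b, hab, ha, hb⟩; exact ⟨a, b, hab, ⟨ha, by simp [hl]⟩, hb, by simp [hl]⟩)
  have h2 := cplx_eq_ncard_add_eR L n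
  change _ ≤ cplx L (n + 1) at h
  omega

theorem ncard_LeftSpecial_add_cplx_le [Fintype A] {L : Set (List A)} (hfac : IsFactorial L)
    (n : ℕ) : (LeftSpecial L n).ncard + cplx L n ≤ cplx L (n + 1) + eL L n := by
  have h := ncard_add_ncard_le_of_extensions (S := {w ∈ Ln L n | LeftProlongable L w})
    (T := LeftSpecial L n) (Ln_finite L (n + 1)) (fun w (a : A) => a :: w)
    (by intro x y a b h; simpa [and_comm] using h)
    (by rintro x ⟨hx, a, ha⟩; exact ⟨a, ha, by simp [hx.2]⟩)
    (by
      rintro x ⟨hl, a, b, -, ha, -⟩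
      exact ⟨⟨hfac _ _ ha ⟨[a], [], by simp⟩, hl⟩, a, ha⟩)
    (by rintro x ⟨hl, a, b, hab, ha, hb⟩; exact ⟨a, b, hab, ⟨ha, by simp [hl]⟩, hb, by simp [hl]⟩)
  have h2 := cplx_eq_ncard_add_eL L n
  change _ ≤ cplx L (n + 1) at h
  omega

theorem LeftProlongable.of_append {L : Set (List A)} (hfac : IsFactorial L) {w y : List A}
    (h : LeftProlongable L (w ++ y)) : LeftProlongable L w := by
  obtain ⟨a, ha⟩ := h
  exact ⟨a, hfac _ _ ha ⟨[], y, by simp⟩⟩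

theorem RightProlongable.of_append {L : Set (List A)} (hfac : IsFactorial L) {x w : List A}
    (h : RightProlongable L (x ++ w)) : RightProlongable L w := by
  obtain ⟨a, ha⟩ := h
  exact ⟨a, hfac _ _ ha ⟨x, [], by simp⟩⟩

/-- Every long word is prolongable on at least one side. -/
theorem leftProlongable_or_rightProlongable [Fintype A] {L : Set (List A)} {N₀ : ℕ}
    (he : ∀ n ≥ N₀, eBoth L n = 0) {w : List A} (hw : w ∈ L) (hl : N₀ ≤ w.length) :
    LeftProlongable L w ∨ RightProlongable L w := by
  by_contra! h
  have hfin : {w' : List A | w' ∈ Ln L w.length ∧ ¬ LeftProlongable L w' ∧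
      ¬ RightProlongable L w'}.Finite := finite_of_length_eq fun _ h => h.1.2
  have h0 : Set.ncard _ = 0 := he _ hl
  rw [Set.ncard_eq_zero hfin] at h0
  exact (Set.eq_empty_iff_forall_notMem.mp h0) w ⟨⟨hw, rfl⟩, h⟩

theorem exists_left_extension [Fintype A] {L : Set (List A)} (hfac : IsFactorial L) {N₀ : ℕ}
    (he : ∀ n ≥ N₀, eBoth L n = 0) {w : List A} (hw : w ∈ L) (hl : N₀ ≤ w.length)
    (hr : ¬ RightProlongable L w) (k : ℕ) : ∃ x, x.length = k ∧ x ++ w ∈ L := by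
  induction k with
  | zero => exact ⟨[], rfl, hw⟩
  | succ k ih =>
    obtain ⟨x, hx, hxw⟩ := ih
    rcases leftProlongable_or_rightProlongable he hxw (by simp; omega) with ⟨a, ha⟩ | h
    · exact ⟨a :: x, by simp [hx], ha⟩
    · exact absurd (h.of_append hfac) hr

theorem exists_right_extension [Fintype A] {L : Set (List A)} (hfac : IsFactorial L) {N₀ : ℕ}
    (he : ∀ n ≥ N₀, eBoth L n = 0) {w : List A} (hw : w ∈ L) (hl : N₀ ≤ w.length)
    (hr : ¬ LeftProlongable L w) (k : ℕ) : ∃ y, y.length = k ∧ w ++ y ∈ L := by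
  induction k with
  | zero => exact ⟨[], rfl, by simpa using hw⟩
  | succ k ih =>
    obtain ⟨y, hy, hwy⟩ := ih
    rcases leftProlongable_or_rightProlongable he hwy (by simp; omega) with h | ⟨a, ha⟩
    · exact absurd (h.of_append hfac) hr
    · exact ⟨y ++ [a], by simp [hy], by simpa using ha⟩

/-- The words of `L` that can be extended to the right by any number of letters. -/
def rightCore (L : Set (List A)) : Set (List A) := {w | ∀ k, ∃ y, y.length = k ∧ w ++ y ∈ L}

theorem rightCore_isFactorial {L : Set (List A)} (hfac : IsFactorial L) :
    IsFactorial (rightCore L) := by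
  rintro u v hu ⟨x, z, rfl⟩ k
  obtain ⟨y, hy, h⟩ := hu (z.length + k)
  refine ⟨(z ++ y).take k, by simp; omega, hfac _ _ h ⟨x, (z ++ y).drop k, ?_⟩⟩
  simp only [List.append_assoc, List.take_append_drop]

theorem rightCore_subset {L : Set (List A)} : rightCore L ⊆ L := by
  intro w hw
  obtain ⟨y, hy, h⟩ := hw 0
  simpa [List.length_eq_zero_iff.mp hy] using h

theorem rightProlongable_rightCore [Fintype A] {L : Set (List A)} (hfac : IsFactorial L)
    {w : List A} (hw : w ∈ rightCore L) : RightProlongable (rightCore L) w := by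
  unfold RightProlongable rightCore
  by_contra! h
  simp only [Set.mem_ofPred_eq, not_forall, not_exists, not_and] at h
  choose k hk using h
  obtain ⟨y, hy, hwy⟩ := hw (Finset.univ.sup k + 1)
  cases y with
  | nil => simp at hy
  | cons a y =>
    have hle : k a ≤ Finset.univ.sup k := Finset.le_sup (Finset.mem_univ a)
    simp only [List.length_cons] at hy
    refine hk a (y.take (k a)) (by simp; omega) (hfac _ _ hwy ⟨[], y.drop (k a), ?_⟩)
    simp

/-- A factorial language in which every word is right-prolongable has at least linear complexity
or bounded complexity. -/
theorem le_cplx_or_bounded [Fintype A] {E : Set (List A)} (hfac : IsFactorial E)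
    (hE : ∀ w ∈ E, RightProlongable E w) :
    (∀ n, n ≤ cplx E n) ∨ ∃ M N, ∀ n ≥ N, cplx E n ≤ M := by
  have heR : ∀ n, eR E n = 0 := by
    intro n
    have : {w : List A | w ∈ Ln E n ∧ ¬ RightProlongable E w} = ∅ := by
      ext w
      simp only [Set.mem_ofPred_eq, Set.mem_empty_iff_false, iff_false, not_and, not_not]
      exact fun h => hE w h.1
    simp [eR, this]
  by_cases hRS : ∀ n, (RightSpecial E n).Nonempty
  · left
    intro n
    induction n with
    | zero => simp
    | succ n ih =>
      have h1 := (Set.ncard_pos (RightSpecial_finite E n)).mpr (hRS n)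
      have h2 := ncard_RightSpecial_add_cplx_le hfac n
      rw [heR] at h2
      omega
  · right
    push Not at hRS
    obtain ⟨N, hN⟩ := hRS
    have hempty : ∀ n ≥ N, RightSpecial E n = ∅ := by
      intro n hn
      by_contra hne
      obtain ⟨w, hl, a, b, hab, ha, hb⟩ := Set.nonempty_iff_ne_empty.mpr hne
      have hsuf : ∀ c : A, w ++ [c] ∈ E → w.drop (n - N) ++ [c] ∈ E := fun c hc =>
        hfac _ _ hc ⟨w.take (n - N), [], by
          rw [List.append_nil, ← List.append_assoc, List.take_append_drop]⟩
      have : w.drop (n - N) ∈ RightSpecial E N :=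
        ⟨by simp; omega, a, b, hab, hsuf a ha, hsuf b hb⟩
      rw [hN] at this
      exact this
    refine ⟨cplx E N, N, fun n hn => ?_⟩
    induction n, hn using Nat.le_induction with
    | base => exact le_rfl
    | succ n hn ih =>
      have := cplx_succ_le hfac n
      rw [hempty n hn] at this
      simp only [Set.ncard_empty, mul_zero, add_zero] at this
      omega

theorem cplx_mono [Fintype A] {E L : Set (List A)} (h : E ⊆ L) (n : ℕ) : cplx E n ≤ cplx L n :=
  Set.ncard_le_ncard (s := Ln E n) (t := Ln L n) (fun _ hw => ⟨h hw.1, hw.2⟩) (Ln_finite L n)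

theorem Ln_reverse_preimage (L : Set (List A)) (n : ℕ) :
    Ln (List.reverse ⁻¹' L) n = List.reverse '' Ln L n := by
  ext w
  simp only [Ln, Set.mem_preimage, Set.mem_ofPred_eq, Set.mem_image]
  constructor
  · rintro ⟨h, hl⟩
    exact ⟨w.reverse, ⟨h, by simpa using hl⟩, by simp⟩
  · rintro ⟨x, ⟨h, hl⟩, rfl⟩
    exact ⟨by simpa using h, by simpa using hl⟩

theorem cplx_reverse_preimage (L : Set (List A)) (n : ℕ) :
    cplx (List.reverse ⁻¹' L) n = cplx L n := by
  change (Ln (List.reverse ⁻¹' L) n).ncard = (Ln L n).ncard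
  rw [Ln_reverse_preimage]
  exact Set.ncard_image_of_injective _ List.reverse_injective

theorem isFactorial_reverse_preimage {L : Set (List A)} (hfac : IsFactorial L) :
    IsFactorial (List.reverse ⁻¹' L) :=
  fun _ _ hu h => hfac _ _ hu (List.reverse_infix.mpr h)

/-- Every long word can be extended indefinitely on one of the two sides. -/
theorem mem_rightCore_or_reverse_mem [Fintype A] {L : Set (List A)} (hfac : IsFactorial L) {N₀ : ℕ}
    (he : ∀ n ≥ N₀, eBoth L n = 0) {w : List A} (hw : w ∈ L) (hl : N₀ ≤ w.length) :
    w ∈ rightCore L ∨ w.reverse ∈ rightCore (List.reverse ⁻¹' L) := by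
  by_contra! h
  obtain ⟨h1, h2⟩ := h
  refine h1 fun k => ?_
  induction k with
  | zero => exact ⟨[], rfl, by simpa using hw⟩
  | succ k ih =>
    obtain ⟨y, hy, hwy⟩ := ih
    by_cases hr : RightProlongable L (w ++ y)
    · obtain ⟨a, ha⟩ := hr
      exact ⟨y ++ [a], by simp [hy], by simpa using ha⟩
    · refine absurd (fun j => ?_) h2
      obtain ⟨x, hx, h⟩ := exists_left_extension hfac he hwy (by simp; omega) hr j
      refine ⟨x.reverse, by simpa using hx, ?_⟩
      simp only [Set.mem_preimage, List.reverse_append, List.reverse_reverse]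
      exact hfac _ _ h ⟨[], y, by simp⟩

theorem cplx_le_add_rightCore [Fintype A] {L : Set (List A)} (hfac : IsFactorial L) {N₀ : ℕ}
    (he : ∀ n ≥ N₀, eBoth L n = 0) {n : ℕ} (hn : N₀ ≤ n) :
    cplx L n ≤ cplx (rightCore L) n + cplx (rightCore (List.reverse ⁻¹' L)) n := by
  have hsub : Ln L n ⊆ Ln (rightCore L) n ∪
      List.reverse '' Ln (rightCore (List.reverse ⁻¹' L)) n := by
    rintro w ⟨hw, hl⟩
    rcases mem_rightCore_or_reverse_mem hfac he hw (by omega) with h | h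
    · exact Or.inl ⟨h, hl⟩
    · exact Or.inr ⟨w.reverse, ⟨h, by simpa using hl⟩, by simp⟩
  calc cplx L n ≤ _ := Set.ncard_le_ncard hsub
        ((Ln_finite _ n).union ((Ln_finite _ n).image _))
    _ ≤ _ := Set.ncard_union_le _ _
    _ ≤ _ := Nat.add_le_add_left (Set.ncard_image_le (Ln_finite _ n)) _

/-- Unbounded complexity is at least linear when all long words are prolongable on some side. -/
theorem le_cplx [Fintype A] {L : Set (List A)} (hfac : IsFactorial L) {N₀ : ℕ}
    (he : ∀ n ≥ N₀, eBoth L n = 0) (hunb : ∀ M : ℕ, ∃ n : ℕ, M < cplx L n) (n : ℕ) :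
    n ≤ cplx L n := by
  have hfac' := isFactorial_reverse_preimage hfac
  rcases le_cplx_or_bounded (rightCore_isFactorial hfac)
    (fun w hw => rightProlongable_rightCore hfac hw) with h | ⟨M, N, hM⟩
  · exact (h n).trans (cplx_mono rightCore_subset n)
  rcases le_cplx_or_bounded (rightCore_isFactorial hfac')
    (fun w hw => rightProlongable_rightCore hfac' hw) with h | ⟨M', N', hM'⟩
  · exact ((h n).trans (cplx_mono rightCore_subset n)).trans (cplx_reverse_preimage L n).le
  obtain ⟨k, hk⟩ := hunb (M + M' + ∑ i ∈ Finset.range (N₀ + N + N'), cplx L i)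
  rcases lt_or_ge k (N₀ + N + N') with h | h
  · have := Finset.single_le_sum (f := fun i => cplx L i) (fun _ _ => Nat.zero_le _)
      (Finset.mem_range.mpr h)
    omega
  · have h1 := cplx_le_add_rightCore hfac he (n := k) (by omega)
    have h2 := hM k (by omega)
    have h3 := hM' k (by omega)
    omega

/-- The positions strictly between `s` and `e` form a maximal interval of positions of `w` at which
the letter agrees with the one `π` places further. -/
def IsMaxRun (π s e : ℕ) (w : List A) : Prop :=
  e + π < w.length ∧ s < e ∧ w[s]? ≠ w[s + π]? ∧ w[e]? ≠ w[e + π]? ∧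
    ∀ k, s < k → k < e → w[k]? = w[k + π]?

theorem IsMaxRun.append {π s e : ℕ} {w : List A} (h : IsMaxRun π s e w) (x y : List A) :
    IsMaxRun π (x.length + s) (x.length + e) (x ++ w ++ y) := by
  obtain ⟨h1, h2, h3, h4, h5⟩ := h
  have key : ∀ k, k < w.length → (x ++ w ++ y)[x.length + k]? = w[k]? := by
    intro k hk
    rw [List.append_assoc, List.getElem?_append_right (by omega), Nat.add_sub_cancel_left,
      List.getElem?_append_left hk]
  refine ⟨by simp; omega, by omega, ?_, ?_, ?_⟩
  · rw [add_assoc, key _ (by omega), key _ (by omega)]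
    exact h3
  · rw [add_assoc, key _ (by omega), key _ (by omega)]
    exact h4
  · intro k hk hk'
    obtain ⟨j, rfl⟩ : ∃ j, k = x.length + j := ⟨k - x.length, by omega⟩
    rw [add_assoc, key _ (by omega), key _ (by omega)]
    exact h5 j (by omega) (by omega)

theorem IsMaxRun.eq_or_le {π s e s' e' : ℕ} {w : List A} (h : IsMaxRun π s e w)
    (h' : IsMaxRun π s' e' w) (hs : s ≤ s') : s = s' ∧ e = e' ∨ e ≤ s' := by
  obtain ⟨-, h2, -, h4, h5⟩ := h
  obtain ⟨-, h2', h3', h4', h5'⟩ := h'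
  rcases hs.eq_or_lt with rfl | hlt
  · rcases lt_trichotomy e e' with hh | hh | hh
    · exact absurd (h5' e h2 hh) h4
    · exact Or.inl ⟨rfl, hh⟩
    · exact absurd (h5 e' h2' hh) h4'
  · right
    by_contra! hh
    exact h3' (h5 s' hlt hh)

/-- Branching words of nearby lengths sharing a long prefix `u` and a long suffix `v` extend to
words of `L` with maximal runs of a common period, the length of the run determining the word. -/
theorem exists_isMaxRun_of_branching {L : Set (List A)} {u v : List A} {m h : ℕ} (hm : 2 * h ≤ m)
    (hu : u.length = m) (hv : v.length = m) {I : Finset ℕ}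
    (hI : ∀ i ∈ I, i < h ∧ ∃ w ∈ Branching L (m + i), u <+: w ∧ v <:+ w) (hcard : 1 < I.card) :
    ∃ π s c, ∀ i ∈ I, m + s ≤ i + c + h ∧
      ∃ W ∈ L, W.length = m + i + 2 ∧ IsMaxRun π s (i + c) W := by
  classical
  have hw : ∀ i ∈ I, i < h ∧ ∃ w ∈ Branching L (m + i), (∀ k < m, w[k]? = u[k]?) ∧
      ∀ k < m, w[i + k]? = v[k]? := by
    intro i hi
    obtain ⟨hih, w, hw, ⟨y, rfl⟩, ⟨x, hx⟩⟩ := hI i hi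
    refine ⟨hih, _, hw, fun k hk => List.getElem?_append_left (by omega), fun k hk => ?_⟩
    have hxl : x.length = i := by
      have h1 := hw.1
      rw [← hx, List.length_append] at h1
      omega
    rw [← hx, List.getElem?_append_right (by omega), hxl, Nat.add_sub_cancel_left]
  have hne : I.Nonempty := Finset.card_pos.mp (by omega)
  obtain ⟨i₁, hi₁, hmin⟩ : ∃ i₁ ∈ I, ∀ i ∈ I, i₁ ≤ i :=
    ⟨I.min' hne, I.min'_mem hne, fun i hi => I.min'_le i hi⟩
  obtain ⟨i₂, hi₂, hne₂⟩ := Finset.exists_mem_ne hcard i₁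
  obtain ⟨π, hπ, rfl⟩ : ∃ π, 0 < π ∧ i₂ = i₁ + π := by
    have := hmin i₂ hi₂
    exact ⟨i₂ - i₁, by omega, by omega⟩
  have huv₁ : ∀ k, i₁ + k < m → u[i₁ + k]? = v[k]? := by
    intro k hk
    obtain ⟨_, w, _, h1, h2⟩ := hw i₁ hi₁
    rw [← h1 _ hk, h2 _ (by omega)]
  have huv₂ : ∀ k, i₁ + π + k < m → u[i₁ + π + k]? = v[k]? := by
    intro k hk
    obtain ⟨_, w, _, h1, h2⟩ := hw _ hi₂
    rw [← h1 _ hk, h2 _ (by omega)]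
  have hlt₂ := (hw _ hi₂).1
  have hPu : ∀ k, i₁ ≤ k → k < m - π → u[k]? = u[k + π]? := by
    intro k hk hk'
    obtain ⟨j, rfl⟩ : ∃ j, k = i₁ + j := ⟨k - i₁, by omega⟩
    rw [huv₁ j (by omega), show i₁ + j + π = i₁ + π + j by ring, huv₂ j (by omega)]
  have hPv : ∀ k, k < m - π - i₁ → v[k]? = v[k + π]? := by
    intro k hk
    rw [← huv₁ k (by omega), ← huv₁ (k + π) (by omega), ← add_assoc]
    exact hPu _ (by omega) (by omega)
  obtain ⟨s, hs₁, hsrun, hsbreak⟩ : ∃ s ≤ i₁, (∀ k, s ≤ k → k < m - π → u[k]? = u[k + π]?) ∧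
      (0 < s → u[s - 1]? ≠ u[s - 1 + π]?) := by
    have hex : ∃ s, ∀ k, s ≤ k → k < m - π → u[k]? = u[k + π]? := ⟨i₁, hPu⟩
    refine ⟨Nat.find hex, Nat.find_min' hex hPu, Nat.find_spec hex, fun hpos heq => ?_⟩
    refine Nat.find_min hex (m := Nat.find hex - 1) (by omega) fun k hk hk' => ?_
    rcases hk.eq_or_lt with rfl | hk
    · exact heq
    · exact Nat.find_spec hex k (by omega) hk'
  obtain ⟨e, he₁, he₂, herun, hebreak⟩ : ∃ e, m - π - i₁ ≤ e ∧ e ≤ m - π ∧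
      (∀ k < e, v[k]? = v[k + π]?) ∧ (e < m - π → v[e]? ≠ v[e + π]?) := by
    have hmax := Nat.le_findGreatest (P := fun e => ∀ k < e, v[k]? = v[k + π]?)
      (n := m - π) (m := m - π - i₁) (by omega) hPv
    have hspec := Nat.findGreatest_spec (P := fun e => ∀ k < e, v[k]? = v[k + π]?)
      (n := m - π) (m := m - π - i₁) (by omega) hPv
    refine ⟨_, hmax, Nat.findGreatest_le _, hspec, fun hlt heq => ?_⟩
    refine Nat.findGreatest_is_greatest (Nat.lt_succ_self _) hlt fun k hk => ?_
    rcases (Nat.lt_succ_iff.mp hk).eq_or_lt with rfl | hk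
    · exact heq
    · exact hspec k hk
  refine ⟨π, s, e + 1, fun i hi => ?_⟩
  have hi₁i := hmin i hi
  obtain ⟨hih, w, ⟨hwl, a, b, hab, ha, hb⟩, hwu, hwv⟩ := hw i hi
  refine ⟨by omega, ?_⟩
  obtain ⟨a', ha', hane⟩ : ∃ a', a' :: w ∈ RightSpecial L (m + i + 1) ∧ some a' ≠ u[π - 1]? := by
    by_cases h : some a = u[π - 1]?
    · refine ⟨b, hb, fun h' => hab ?_⟩
      simpa using h.trans h'.symm
    · exact ⟨a, ha, h⟩
  obtain ⟨-, c, d, hcd, hc, hd⟩ := ha'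
  obtain ⟨c', hc', hcne⟩ : ∃ c', a' :: w ++ [c'] ∈ L ∧ v[m - π]? ≠ some c' := by
    by_cases h : v[m - π]? = some c
    · refine ⟨d, hd, fun h' => hcd ?_⟩
      simpa using h.symm.trans h'
    · exact ⟨c, hc, h⟩
  have hW0 : (a' :: w ++ [c'])[0]? = some a' := by simp
  have hW : ∀ k < m + i, (a' :: w ++ [c'])[k + 1]? = w[k]? := by
    intro k hk
    rw [List.cons_append, List.getElem?_cons_succ, List.getElem?_append_left (by omega)]
  have hWl : (a' :: w ++ [c'])[m + i + 1]? = some c' := by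
    rw [List.cons_append, List.getElem?_cons_succ, List.getElem?_append_right (by omega), hwl]
    simp
  refine ⟨_, hc', by simp [hwl], by simp; omega, by omega, ?_, ?_, ?_⟩
  · rcases Nat.eq_zero_or_pos s with rfl | hpos
    · rw [hW0, show 0 + π = π - 1 + 1 by omega, hW _ (by omega), hwu _ (by omega)]
      exact hane
    · rw [show s = s - 1 + 1 by omega, hW _ (by omega), hwu _ (by omega),
        show s - 1 + 1 + π = s - 1 + π + 1 by omega, hW _ (by omega), hwu _ (by omega)]
      exact hsbreak hpos
  · rw [← add_assoc, hW _ (by omega), hwv _ (by omega)]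
    rcases he₂.eq_or_lt with heq | hlt
    · rw [show i + e + 1 + π = m + i + 1 by omega, hWl, heq]
      exact hcne
    · rw [show i + e + 1 + π = i + (e + π) + 1 by omega, hW _ (by omega), hwv _ (by omega)]
      exact hebreak hlt
  · intro k hk hk'
    obtain ⟨j, rfl⟩ : ∃ j, k = j + 1 := ⟨k - 1, by omega⟩
    rw [hW _ (by omega), show j + 1 + π = j + π + 1 by omega, hW _ (by omega)]
    rcases lt_or_ge j (m - π) with hj | hj
    · rw [hwu _ (by omega), hwu _ (by omega)]
      exact hsrun j (by omega) hj
    · obtain ⟨l, rfl⟩ : ∃ l, j = i + l := ⟨j - i, by omega⟩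
      rw [hwv _ (by omega), add_assoc, hwv _ (by omega)]
      exact herun l (by omega)

theorem IsMaxRun.occurrence_unique {π s c i j D : ℕ} {x y x' y' W W' : List A}
    (h : IsMaxRun π s (i + c) W) (h' : IsMaxRun π s (j + c) W') (hD : D + s ≤ i + c)
    (hD' : D + s ≤ j + c) (hD₀ : 0 < D) (heq : x ++ W ++ y = x' ++ W' ++ y')
    (hdiv : x.length / D = x'.length / D) : i = j ∧ x.length = x'.length := by
  have h1 := h.append x y
  have h2 := h'.append x' y'
  rw [← heq] at h2
  have hx := Nat.div_add_mod x.length D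
  have hx' := Nat.div_add_mod x'.length D
  rw [hdiv] at hx
  have hr := Nat.mod_lt x.length hD₀
  have hr' := Nat.mod_lt x'.length hD₀
  rcases le_total x.length x'.length with hle | hle
  · rcases h1.eq_or_le h2 (by omega) with h3 | h3 <;> omega
  · rcases h2.eq_or_le h1 (by omega) with h3 | h3 <;> omega

/-- Occurrences of words with long maximal runs of a common period in words of length `N` are
separated, so that there are few of them. -/
theorem card_occurrences_le {π s c D N : ℕ} {W : ℕ → List A} {E : Set (List A)} (hE : E.Finite)
    (hEN : ∀ z ∈ E, z.length = N) (hD₀ : 0 < D) (hN : N < 4 * D) {J : Finset (ℕ × ℕ)}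
    (hrun : ∀ p ∈ J, IsMaxRun π s (p.1 + c) (W p.1)) (hD : ∀ p ∈ J, D + s ≤ p.1 + c)
    (hJ : ∀ p ∈ J, ∃ x y, x.length = p.2 ∧ x ++ W p.1 ++ y ∈ E) :
    J.card ≤ 4 * E.ncard := by
  choose! x y hx hxy using hJ
  have hmaps : ∀ p ∈ J, (p.2 / D, x p ++ W p.1 ++ y p) ∈ Finset.range 4 ×ˢ hE.toFinset := by
    intro p hp
    have hl := hEN _ (hxy p hp)
    simp only [List.length_append, hx p hp] at hl
    refine Finset.mem_product.mpr ⟨Finset.mem_range.mpr ?_, hE.mem_toFinset.mpr (hxy p hp)⟩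
    exact (Nat.div_lt_iff_lt_mul hD₀).mpr (by omega)
  have hinj : Set.InjOn (fun p : ℕ × ℕ => (p.2 / D, x p ++ W p.1 ++ y p)) J := by
    intro p hp q hq hpq
    simp only [Prod.mk.injEq] at hpq
    have := (hrun p hp).occurrence_unique (hrun q hq) (hD p hp) (hD q hq) hD₀ hpq.2
      (by rw [hx p hp, hx q hq]; exact hpq.1)
    rw [hx p hp, hx q hq] at this
    exact Prod.ext this.1 this.2
  have := Finset.card_le_card_of_injOn _ hmaps hinj
  rwa [Finset.card_product, Finset.card_range, ← Set.ncard_eq_toFinset_card E hE] at this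

/-- A word none of whose extensions of length `N` is deficient can be extended freely within words
of length `N`. -/
theorem exists_extension_of_forall_prolongable [Fintype A] {L : Set (List A)}
    (hfac : IsFactorial L) {N₀ N : ℕ} (he : ∀ n ≥ N₀, eBoth L n = 0) {W : List A} (hW : W ∈ L)
    (hl : N₀ ≤ W.length)
    (hgood : ∀ x y, x ++ W ++ y ∈ L → (x ++ W ++ y).length = N →
      LeftProlongable L (x ++ W ++ y) ∧ RightProlongable L (x ++ W ++ y))
    (a b : ℕ) (hab : a + W.length + b ≤ N) :
    ∃ x y, x.length = a ∧ y.length = b ∧ x ++ W ++ y ∈ L := by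
  have hprol : ∀ x y, x ++ W ++ y ∈ L → (x ++ W ++ y).length ≤ N →
      LeftProlongable L (x ++ W ++ y) ∧ RightProlongable L (x ++ W ++ y) := by
    intro x y hxy hlen
    have hlong : N₀ ≤ (x ++ W ++ y).length := by simp; omega
    constructor
    · by_contra hc
      obtain ⟨z, hz, h⟩ := exists_right_extension hfac he hxy hlong hc (N - (x ++ W ++ y).length)
      have hassoc : x ++ W ++ y ++ z = x ++ W ++ (y ++ z) := by simp
      have hg := (hgood x (y ++ z) (hassoc ▸ h) (by
        rw [← hassoc, List.length_append (as := x ++ W ++ y)]; omega)).1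
      rw [← hassoc] at hg
      exact hc (hg.of_append hfac)
    · by_contra hc
      obtain ⟨z, hz, h⟩ := exists_left_extension hfac he hxy hlong hc (N - (x ++ W ++ y).length)
      have hassoc : z ++ (x ++ W ++ y) = z ++ x ++ W ++ y := by simp
      have hg := (hgood (z ++ x) y (hassoc ▸ h) (by
        rw [← hassoc, List.length_append (as := z)]; omega)).2
      rw [← hassoc] at hg
      exact hc (hg.of_append hfac)
  induction b with
  | succ b ih =>
    obtain ⟨x, y, hx, hy, h⟩ := ih (by omega)
    obtain ⟨l, hl⟩ := (hprol x y h (by simp; omega)).2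
    exact ⟨x, y ++ [l], hx, by simp [hy], by simpa using hl⟩
  | zero =>
    induction a with
    | zero => exact ⟨[], [], rfl, rfl, by simpa using hW⟩
    | succ a ih =>
      obtain ⟨x, y, hx, hy, h⟩ := ih (by omega)
      obtain ⟨l, hl⟩ := (hprol x y h (by simp; omega)).1
      exact ⟨l :: x, y, by simp [hx], hy, hl⟩

theorem card_mul_le_of_isMaxRun [Fintype A] {L : Set (List A)} (hfac : IsFactorial L) {N₀ : ℕ}
    (he : ∀ n ≥ N₀, eBoth L n = 0) {π s c D N T : ℕ} {W : ℕ → List A} {I : Finset ℕ}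
    (hD₀ : 0 < D) (hN : N < 4 * D) (hrun : ∀ i ∈ I, IsMaxRun π s (i + c) (W i))
    (hD : ∀ i ∈ I, D + s ≤ i + c) (hW : ∀ i ∈ I, W i ∈ L) (hl : ∀ i ∈ I, N₀ ≤ (W i).length)
    (hT : ∀ i ∈ I, T + (W i).length ≤ N + 1) :
    I.card * T ≤ 4 * (eL L N + eR L N) * T + 4 * cplx L N := by
  classical
  let E : Set (List A) := {z | z ∈ Ln L N ∧ ¬ LeftProlongable L z} ∪
    {z | z ∈ Ln L N ∧ ¬ RightProlongable L z}
  have hEN : ∀ z ∈ E, z.length = N := by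
    rintro z (hz | hz)
    · exact hz.1.2
    · exact hz.1.2
  have hE : E.Finite := finite_of_length_eq hEN
  have hEcard : E.ncard ≤ eL L N + eR L N := Set.ncard_union_le _ _
  let P : ℕ → Prop := fun i => ∃ x y, x ++ W i ++ y ∈ E
  have hbad : (I.filter P).card ≤ 4 * E.ncard := by
    have hP : ∀ i ∈ I.filter P, ∃ t x y, x.length = t ∧ x ++ W i ++ y ∈ E := by
      intro i hi
      obtain ⟨x, y, h⟩ := (Finset.mem_filter.mp hi).2
      exact ⟨x.length, x, y, rfl, h⟩
    choose! t ht using hP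
    have hcard : ((I.filter P).image fun i => (i, t i)).card = (I.filter P).card :=
      Finset.card_image_of_injective _ fun i j h => (Prod.mk.inj h).1
    rw [← hcard]
    refine card_occurrences_le (π := π) (s := s) (c := c) (W := W) hE hEN hD₀ hN ?_ ?_ ?_
    all_goals
      intro p hp
      obtain ⟨i, hi, rfl⟩ := Finset.mem_image.mp hp
    · exact hrun i (Finset.mem_filter.mp hi).1
    · exact hD i (Finset.mem_filter.mp hi).1
    · exact ht i hi
  have hgood : (I.filter fun i => ¬ P i).card * T ≤ 4 * cplx L N := by
    have hcard : ((I.filter fun i => ¬ P i) ×ˢ Finset.range T).card =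
        (I.filter fun i => ¬ P i).card * T := by
      rw [Finset.card_product, Finset.card_range]
    rw [← hcard]
    refine card_occurrences_le (π := π) (s := s) (c := c) (W := W) (Ln_finite L N) (fun z hz => hz.2) hD₀ hN ?_ ?_ ?_
    all_goals
      rintro ⟨i, t⟩ hp
      obtain ⟨hi, ht⟩ := Finset.mem_product.mp hp
      obtain ⟨hi, hPi⟩ := Finset.mem_filter.mp hi
    · exact hrun i hi
    · exact hD i hi
    · have ht' : t < T := Finset.mem_range.mp ht
      have hTi := hT i hi
      obtain ⟨x, y, hx, hy, h⟩ := exists_extension_of_forall_prolongable hfac he (hW i hi) (hl i hi)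
        (N := N) (fun x y hxy hlen => by
          constructor
          · by_contra hc
            exact hPi ⟨x, y, Or.inl ⟨⟨hxy, hlen⟩, hc⟩⟩
          · by_contra hc
            exact hPi ⟨x, y, Or.inr ⟨⟨hxy, hlen⟩, hc⟩⟩)
        t (N - t - (W i).length) (by omega)
      exact ⟨x, y, hx, h, by simp; omega⟩
  have hsplit := Finset.card_filter_add_card_filter_not (s := I) P
  calc I.card * T = (I.filter P).card * T + (I.filter fun i => ¬ P i).card * T := by
        rw [← hsplit, add_mul]
    _ ≤ 4 * (eL L N + eR L N) * T + 4 * cplx L N :=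
        add_le_add (Nat.mul_le_mul_right T (hbad.trans (Nat.mul_le_mul_left 4 hEcard))) hgood

/-- The number of lengths in `[m, n)` of branching words with a given prefix and a given suffix of
length `m`. -/
theorem card_branching_lengths_le [Fintype A] {L : Set (List A)} (hfac : IsFactorial L) {N₀ : ℕ}
    (he : ∀ n ≥ N₀, eBoth L n = 0) {m h : ℕ} (hm : N₀ ≤ m) (hh : 0 < h) (hmh : 7 * h ≤ m)
    {u v : List A} (hu : u.length = m) (hv : v.length = m) {I : Finset ℕ}
    (hI : ∀ i ∈ I, i < h ∧ ∃ w ∈ Branching L (m + i), u <+: w ∧ v <:+ w) :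
    I.card * (m + h) ≤ (m + h) + (4 * (eL L (2 * (m + h) + 1) + eR L (2 * (m + h) + 1)) * (m + h) +
      4 * cplx L (2 * (m + h) + 1)) := by
  rcases le_or_gt I.card 1 with hle | hlt
  · calc I.card * (m + h) ≤ 1 * (m + h) := Nat.mul_le_mul_right _ hle
      _ ≤ _ := by omega
  · obtain ⟨π, s, c, hc⟩ := exists_isMaxRun_of_branching (by omega) hu hv hI hlt
    have hW : ∀ i ∈ I, ∃ W ∈ L, W.length = m + i + 2 ∧ IsMaxRun π s (i + c) W :=
      fun i hi => (hc i hi).2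
    choose! W hWL hWl hrun using hW
    refine (card_mul_le_of_isMaxRun hfac he (D := m - h) (by omega) (by omega) hrun ?_ hWL ?_
      ?_).trans (Nat.le_add_left _ _)
    · intro i hi
      have := (hc i hi).1
      omega
    · intro i hi
      rw [hWl i hi]
      omega
    · intro i hi
      rw [hWl i hi]
      have := (hI i hi).1
      omega

/-- Branching words are counted by their length, prefix and suffix. -/
theorem sum_ncard_branching_le [Fintype A] {L : Set (List A)} (hfac : IsFactorial L) {m h Q : ℕ}
    (hmh : h ≤ m)
    (hQ : ∀ u v : List A, u.length = m → v.length = m → ∀ I : Finset ℕ,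
      (∀ i ∈ I, i < h ∧ ∃ w ∈ Branching L (m + i), u <+: w ∧ v <:+ w) → I.card ≤ Q) :
    ∑ i ∈ Finset.range h, (Branching L (m + i)).ncard ≤
      (LeftSpecial L m).ncard * (RightSpecial L m).ncard * Q := by
  classical
  let F : Finset (List A × List A) :=
    (LeftSpecial_finite L m).toFinset ×ˢ (RightSpecial_finite L m).toFinset
  let R : ℕ → List A × List A → Prop := fun i p =>
    ∃ w ∈ Branching L (m + i), p.1 <+: w ∧ p.2 <:+ w
  have hF : F.card = (LeftSpecial L m).ncard * (RightSpecial L m).ncard := by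
    rw [Finset.card_product, ← Set.ncard_eq_toFinset_card _ (LeftSpecial_finite L m),
      ← Set.ncard_eq_toFinset_card _ (RightSpecial_finite L m)]
  have h1 : ∀ i ∈ Finset.range h, (Branching L (m + i)).ncard ≤ (F.filter (R i)).card := by
    intro i hi
    have hih : i < h := Finset.mem_range.mp hi
    rw [Set.ncard_eq_toFinset_card _ (Branching_finite L (m + i))]
    refine Finset.card_le_card_of_injOn (fun w => (w.take m, w.drop i)) ?_ ?_
    · intro w hw
      have hw : w ∈ Branching L (m + i) := by simpa using hw
      have hw' := hw
      obtain ⟨hl, a, b, hab, ⟨-, c, d, hcd, hac, had⟩, -, c', d', -, hbc, -⟩ := hw'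
      have htake : ∀ x y : A, x :: w ++ [y] ∈ L → x :: w.take m ∈ L := fun x y hxy =>
        hfac _ _ hxy ⟨[], w.drop m ++ [y], by simp [← List.append_assoc]⟩
      have hdrop : ∀ x y : A, x :: w ++ [y] ∈ L → w.drop i ++ [y] ∈ L := fun x y hxy =>
        hfac _ _ hxy ⟨x :: w.take i, [], by simp [← List.append_assoc]⟩
      simp only [Finset.coe_filter, Set.mem_ofPred_eq, F, Finset.mem_product,
        Set.Finite.mem_toFinset]
      exact ⟨⟨⟨by simp; omega, a, b, hab, htake _ _ hac, htake _ _ hbc⟩,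
        ⟨by simp; omega, c, d, hcd, hdrop _ _ hac, hdrop _ _ had⟩⟩,
        w, hw, List.take_prefix _ _, List.drop_suffix _ _⟩
    · intro w hw w' hw' heq
      have hw : w ∈ Branching L (m + i) := by simpa using hw
      have hw' : w' ∈ Branching L (m + i) := by simpa using hw'
      simp only [Prod.mk.injEq] at heq
      have h3 : w.take i = w'.take i := by
        have := congrArg (List.take i) heq.1
        rwa [List.take_take, List.take_take, min_eq_left (by omega)] at this
      rw [← List.take_append_drop i w, ← List.take_append_drop i w', h3, heq.2]
  have h2 : ∀ p ∈ F, ((Finset.range h).filter fun i => R i p).card ≤ Q := by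
    intro p hp
    simp only [F, Finset.mem_product, Set.Finite.mem_toFinset] at hp
    refine hQ p.1 p.2 hp.1.1 hp.2.1 _ fun i hi => ?_
    simpa using hi
  calc ∑ i ∈ Finset.range h, (Branching L (m + i)).ncard
      ≤ ∑ i ∈ Finset.range h, (F.filter (R i)).card := Finset.sum_le_sum h1
    _ = ∑ p ∈ F, ((Finset.range h).filter fun i => R i p).card :=
        Finset.sum_card_bipartiteAbove_eq_sum_card_bipartiteBelow R
    _ ≤ ∑ p ∈ F, Q := Finset.sum_le_sum h2
    _ = _ := by rw [Finset.sum_const, smul_eq_mul, hF]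

/-- A cubic bound for the first difference of the complexity. -/
theorem cplx_succ_le_add_cube [Fintype A] {L : Set (List A)} (hfac : IsFactorial L) {N₀ : ℕ}
    (he : ∀ n ≥ N₀, eBoth L n = 0) {n : ℕ} (hn : 16 ≤ n) (hnN : 2 * N₀ ≤ n) {x : ℝ} (hx : 1 ≤ x)
    (hl : ∀ k, n ≤ 2 * k → k ≤ 3 * n → (eL L k : ℝ) ≤ x)
    (hr : ∀ k, n ≤ 2 * k → k ≤ 3 * n → (eR L k : ℝ) ≤ x)
    (hp : ∀ k, n ≤ 2 * k → k ≤ 3 * n → (cplx L k : ℝ) ≤ x * n) :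
    (cplx L (n + 1) : ℝ) ≤ cplx L n +
      Fintype.card (Option A) * (17 + 3757 * Fintype.card (Option A)) * x ^ 3 := by
  obtain ⟨h, hh₁, hh₂⟩ : ∃ h, 8 * h ≤ n ∧ n ≤ 16 * h := ⟨n / 8, by omega, by omega⟩
  obtain ⟨j, hj, hdiff⟩ : ∃ j ∈ Finset.range h,
      (cplx L (n - h + (j + 1)) : ℝ) - cplx L (n - h + j) ≤ 16 * x := by
    refine Finset.exists_le_of_sum_le (Finset.nonempty_range_iff.mpr (by omega)) ?_
    rw [Finset.sum_range_sub (fun j => (cplx L (n - h + j) : ℝ)), Finset.sum_const,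
      Finset.card_range, nsmul_eq_mul, Nat.sub_add_cancel (by omega)]
    have h1 := hp n (by omega) (by omega)
    have h2 : (n : ℝ) ≤ 16 * h := by exact_mod_cast hh₂
    have h3 : (0 : ℝ) ≤ cplx L (n - h + 0) := Nat.cast_nonneg _
    nlinarith
  have hjh : j < h := Finset.mem_range.mp hj
  rw [← add_assoc] at hdiff
  obtain ⟨m, hm⟩ : ∃ m, n - h + j = m := ⟨_, rfl⟩
  obtain ⟨d, hd⟩ : ∃ d, n = m + d := ⟨n - m, by omega⟩
  rw [hm] at hdiff
  have hRS : ((RightSpecial L m).ncard : ℝ) ≤ 17 * x := by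
    have h1 : ((RightSpecial L m).ncard : ℝ) + cplx L m ≤ cplx L (m + 1) + eR L m := by
      exact_mod_cast ncard_RightSpecial_add_cplx_le hfac m
    have h2 := hr m (by omega) (by omega)
    linarith
  have hLS : ((LeftSpecial L m).ncard : ℝ) ≤ 17 * x := by
    have h1 : ((LeftSpecial L m).ncard : ℝ) + cplx L m ≤ cplx L (m + 1) + eL L m := by
      exact_mod_cast ncard_LeftSpecial_add_cplx_le hfac m
    have h2 := hl m (by omega) (by omega)
    linarith
  have hQ := sum_ncard_branching_le hfac (m := m) (h := d) (Q := ⌊13 * x⌋₊) (by omega) (by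
    intro u v hu hv I hI
    have hcard := card_branching_lengths_le hfac he (by omega) (by omega) (by omega) hu hv hI
    rw [← hd] at hcard
    have hcard' : (I.card : ℝ) * n ≤ n + (4 * (eL L (2 * n + 1) + eR L (2 * n + 1)) * n +
      4 * cplx L (2 * n + 1)) := by exact_mod_cast hcard
    have h1 := hl (2 * n + 1) (by omega) (by omega)
    have h2 := hr (2 * n + 1) (by omega) (by omega)
    have h3 := hp (2 * n + 1) (by omega) (by omega)
    have hn0 : (0 : ℝ) < n := by exact_mod_cast (by omega : 0 < n)
    refine Nat.le_floor (le_of_mul_le_mul_right ?_ hn0)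
    nlinarith)
  have hQ' : ((∑ i ∈ Finset.range d, (Branching L (m + i)).ncard : ℕ) : ℝ) ≤ 3757 * x ^ 3 := by
    calc ((∑ i ∈ Finset.range d, (Branching L (m + i)).ncard : ℕ) : ℝ)
        ≤ (LeftSpecial L m).ncard * (RightSpecial L m).ncard * (⌊13 * x⌋₊ : ℝ) := by
          exact_mod_cast hQ
      _ ≤ (17 * x) * (17 * x) * (13 * x) := by
          gcongr
          exact Nat.floor_le (by linarith)
      _ = 3757 * x ^ 3 := by ring
  have hRSn : ((RightSpecial L n).ncard : ℝ) ≤ (RightSpecial L m).ncard +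
      Fintype.card (Option A) * (∑ i ∈ Finset.range d, (Branching L (m + i)).ncard : ℕ) := by
    rw [hd]
    exact_mod_cast ncard_RightSpecial_add_le hfac m d
  have hlast : (cplx L (n + 1) : ℝ) ≤
      cplx L n + Fintype.card (Option A) * (RightSpecial L n).ncard := by
    exact_mod_cast cplx_succ_le hfac n
  have hx3 : x ≤ x ^ 3 := le_self_pow₀ hx (by norm_num)
  calc (cplx L (n + 1) : ℝ) ≤ _ := hlast
    _ ≤ cplx L n + Fintype.card (Option A) *
        (17 * x ^ 3 + Fintype.card (Option A) * (3757 * x ^ 3)) := by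
      gcongr
      refine hRSn.trans ?_
      gcongr
      linarith
    _ = _ := by ring

/-- A power bound at a length comparable with `n` gives a power bound in `n`. -/
theorem le_rpow_of_le_three_mul {C a b y : ℝ} {k n : ℕ} (ha : 0 ≤ a) (ha₂ : a ≤ 2)
    (hab : a ≤ b) (hn : 1 ≤ n) (hk : k ≤ 3 * n) (hy : y ≤ C * (k : ℝ) ^ a) :
    y ≤ 9 * |C| * (n : ℝ) ^ b := by
  have hn' : (1 : ℝ) ≤ n := by exact_mod_cast hn
  have hk' : (k : ℝ) ≤ 3 * n := by exact_mod_cast hk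
  calc y ≤ C * (k : ℝ) ^ a := hy
    _ ≤ |C| * (3 * n : ℝ) ^ a := by
      gcongr
      exact le_abs_self C
    _ = |C| * ((3 : ℝ) ^ a * (n : ℝ) ^ a) := by
      rw [Real.mul_rpow (by norm_num) (by positivity)]
    _ ≤ |C| * ((3 : ℝ) ^ (2 : ℝ) * (n : ℝ) ^ b) := by
      gcongr
      norm_num
    _ = 9 * |C| * (n : ℝ) ^ b := by norm_num; ring

theorem complexity_ratio_tendsto_one_of_bigO {A : Type*} [Fintype A]
    (L : Set (List A)) (hfac : IsFactorial L) (hap : AlmostProlongable L)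
    (hunb : ∀ M : ℕ, ∃ n : ℕ, M < cplx L n)
    (N₀ : ℕ) (he : ∀ n ≥ N₀, eBoth L n = 0)
    (α β : ℝ) (hα : α ∈ Set.Ico (0 : ℝ) (1 / 3)) (hβ : β ∈ Set.Ico (1 : ℝ) (4 / 3))
    (helO : ∃ C : ℝ, ∃ N : ℕ, ∀ n ≥ N, (eL L n : ℝ) ≤ C * (n : ℝ) ^ α)
    (herO : ∃ C : ℝ, ∃ N : ℕ, ∀ n ≥ N, (eR L n : ℝ) ≤ C * (n : ℝ) ^ α)
    (hpO : ∃ C : ℝ, ∃ N : ℕ, ∀ n ≥ N, (cplx L n : ℝ) ≤ C * (n : ℝ) ^ β) :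
    Tendsto (fun n => (cplx L (n + 1) : ℝ) / (cplx L n : ℝ)) atTop (𝓝 1) := by
  classical
  obtain ⟨hα₀, hα₁⟩ := hα
  obtain ⟨hβ₁, hβ₂⟩ := hβ
  obtain ⟨Cl, Nl, hCl⟩ := helO
  obtain ⟨Cr, Nr, hCr⟩ := herO
  obtain ⟨Cp, Np, hCp⟩ := hpO
  obtain ⟨γ, hαγ, hβγ, hγ⟩ : ∃ γ : ℝ, α ≤ γ ∧ β ≤ γ + 1 ∧ 3 * γ < 1 :=
    ⟨max α (β - 1), le_max_left _ _, by linarith [le_max_right α (β - 1)],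
      by rcases max_choice α (β - 1) with h | h <;> rw [h] <;> linarith⟩
  have hγ₀ : 0 ≤ γ := hα₀.trans hαγ
  set B : ℝ := 1 + 9 * |Cl| + 9 * |Cr| + 9 * |Cp| with hB
  have hB₁ : 1 ≤ B := by
    have := abs_nonneg Cl
    have := abs_nonneg Cr
    have := abs_nonneg Cp
    linarith
  set D : ℝ := Fintype.card (Option A) * (17 + 3757 * Fintype.card (Option A)) * B ^ 3 with hD
  have hlin := le_cplx hfac he hunb
  have hupper : ∀ᶠ n : ℕ in atTop,
      (cplx L (n + 1) : ℝ) / cplx L n ≤ 1 + D * (n : ℝ) ^ (-(1 - 3 * γ)) := by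
    filter_upwards [eventually_ge_atTop (16 + 2 * N₀ + 2 * Nl + 2 * Nr + 2 * Np)] with n hn
    have hn1 : (1 : ℝ) ≤ n := by exact_mod_cast (by omega : 1 ≤ n)
    have hn0 : (0 : ℝ) < n := by linarith
    have hpow : 1 ≤ (n : ℝ) ^ γ := Real.one_le_rpow hn1 hγ₀
    have hbound : ∀ {C : ℝ}, 9 * |C| ≤ B → 9 * |C| * (n : ℝ) ^ γ ≤ B * (n : ℝ) ^ γ :=
      fun h => mul_le_mul_of_nonneg_right h (by linarith)
    have key := cplx_succ_le_add_cube hfac he (n := n) (x := B * (n : ℝ) ^ γ) (by omega)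
      (by omega) (by nlinarith)
      (fun k hk hk' => (le_rpow_of_le_three_mul hα₀ (by linarith) hαγ (by omega) hk'
        (hCl k (by omega))).trans (hbound (by linarith [abs_nonneg Cr, abs_nonneg Cp])))
      (fun k hk hk' => (le_rpow_of_le_three_mul hα₀ (by linarith) hαγ (by omega) hk'
        (hCr k (by omega))).trans (hbound (by linarith [abs_nonneg Cl, abs_nonneg Cp])))
      (fun k hk hk' => by
        have h1 := le_rpow_of_le_three_mul (by linarith) (by linarith) hβγ (by omega) hk'
          (hCp k (by omega))
        rw [Real.rpow_add hn0, Real.rpow_one, ← mul_assoc] at h1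
        exact h1.trans (mul_le_mul_of_nonneg_right
          (hbound (by linarith [abs_nonneg Cl, abs_nonneg Cr])) hn0.le))
    have hpn : (n : ℝ) ≤ cplx L n := by exact_mod_cast hlin n
    have hpos : (0 : ℝ) < cplx L n := by linarith
    have hD₀ : 0 ≤ D := by positivity
    have hcube : (B * (n : ℝ) ^ γ) ^ 3 = B ^ 3 * ((n : ℝ) ^ (-(1 - 3 * γ)) * n) := by
      rw [mul_pow, ← Real.rpow_natCast ((n : ℝ) ^ γ), ← Real.rpow_mul hn0.le]
      congr 1
      nth_rewrite 3 [← Real.rpow_one (n : ℝ)]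
      rw [← Real.rpow_add hn0]
      congr 1
      push_cast
      ring
    rw [div_le_iff₀ hpos]
    calc (cplx L (n + 1) : ℝ) ≤ _ := key
      _ = cplx L n + D * (n : ℝ) ^ (-(1 - 3 * γ)) * n := by rw [hcube, hD]; ring
      _ ≤ cplx L n + D * (n : ℝ) ^ (-(1 - 3 * γ)) * cplx L n := by gcongr
      _ = _ := by ring
  have hlower : ∀ᶠ n : ℕ in atTop,
      1 - (eR L n : ℝ) / cplx L n ≤ (cplx L (n + 1) : ℝ) / cplx L n := by
    filter_upwards [eventually_ge_atTop 1] with n hn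
    have hpos : (0 : ℝ) < cplx L n := by exact_mod_cast lt_of_lt_of_le hn (hlin n)
    have h1 : ((RightSpecial L n).ncard : ℝ) + cplx L n ≤ cplx L (n + 1) + eR L n := by
      exact_mod_cast ncard_RightSpecial_add_cplx_le hfac n
    have h2 : (0 : ℝ) ≤ (RightSpecial L n).ncard := Nat.cast_nonneg _
    rw [sub_le_iff_le_add, ← add_div, le_div_iff₀ hpos]
    linarith
  refine tendsto_of_tendsto_of_tendsto_of_le_of_le' ?_ ?_ hlower hupper
  · simpa using hap.2.const_sub 1
  · have h1 := (tendsto_rpow_neg_atTop (y := 1 - 3 * γ) (by linarith)).comp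
      (tendsto_natCast_atTop_atTop (R := ℝ))
    simpa using (h1.const_mul D).const_add 1
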